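/- Let α0,α1,α2,α3,α4 be complex numbers with α0+α1+2α2+2α3+2α4=1, and let (x,y,z,w) be a rational solution of the Sasano system B4(α0,α1,α2,α3,α4). Then x is holomorphic at t=0 and has a finite limit L as t→∞, the difference L − x(0) is an integer, and moreover y+w is holomorphic at t=∞ with t·(y(t)+w(t)−M) → 0 as t→∞, where M is the limit of y+w at t=∞ (i.e., the coefficient of 1/t in the expansion of y+w at ∞ vanishes). -/

import Mathlib

open Filter Topology Polynomial

noncomputable section

/-- The four equations of the Sasano system of type `B₄⁽¹⁾` at the point `t`. -/
def B4Eqs (a0 a1 a2 a3 a4 : ℂ) (x y z w : ℂ → ℂ) (t : ℂ) : Prop :=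
  (t * deriv x t =
      2 * x t ^ 2 * y t - x t ^ 2 + (1 - 2*a2 - 2*a3 - 2*a4) * x t
        + 2 * a3 * z t + 2 * z t ^ 2 * w t + t) ∧
  (t * deriv y t =
      -2 * x t * y t ^ 2 + 2 * x t * y t - (1 - 2*a2 - 2*a3 - 2*a4) * y t + a1) ∧
  (t * deriv z t =
      2 * z t ^ 2 * w t - z t ^ 2 + (1 - 2*a4) * z t + 2 * y t * z t ^ 2 + t) ∧
  (t * deriv w t =
      -2 * z t * w t ^ 2 + 2 * z t * w t - (1 - 2*a4) * w t
        - 2 * a3 * y t - 4 * y t * z t * w t + a3)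

/-- A complex rational function: a quotient of two polynomials (with junk value `0`
at poles), regarded as a function on `ℂ`. -/
def IsRatFn (f : ℂ → ℂ) : Prop :=
  ∃ p q : Polynomial ℂ, q ≠ 0 ∧ ∀ t : ℂ, f t = p.eval t / q.eval t

/-- A rational solution of the Sasano system `B₄⁽¹⁾`: a quadruple of rational functions
satisfying the four equations outside a finite set. -/
def IsRatSolB4 (a0 a1 a2 a3 a4 : ℂ) (x y z w : ℂ → ℂ) : Prop :=
  IsRatFn x ∧ IsRatFn y ∧ IsRatFn z ∧ IsRatFn w ∧
    ∃ S : Set ℂ, S.Finite ∧ ∀ t ∉ S, B4Eqs a0 a1 a2 a3 a4 x y z w t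
/-- The filter of neighbourhoods of `t = ∞` in `ℂ`. -/
def atInfty : Filter ℂ := Filter.comap (fun t : ℂ => ‖t‖) Filter.atTop

/-- `Lim f n a`: the function `τ ^ n * f τ` tends to `a` as `τ → 0`, i.e. `f` has a pole of order
at most `n` with leading coefficient `a`. -/
def Lim (f : ℂ → ℂ) (n : ℤ) (a : ℂ) : Prop :=
  Tendsto (fun τ : ℂ => τ ^ n * f τ) (𝓝[≠] 0) (𝓝 a)

theorem Lim.congr {f g : ℂ → ℂ} {n : ℤ} {a : ℂ} (h : Lim f n a) (hfg : ∀ᶠ τ in 𝓝[≠] (0:ℂ), f τ = g τ) :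
    Lim g n a := by
  refine Tendsto.congr' ?_ h
  filter_upwards [hfg] with τ hτ
  rw [hτ]

theorem Lim.cast {f : ℂ → ℂ} {n m : ℤ} {a b : ℂ} (h : Lim f n a) (hn : n = m) (ha : a = b) :
    Lim f m b := by subst hn ha; exact h

theorem Lim.add {f g : ℂ → ℂ} {n : ℤ} {a b : ℂ} (hf : Lim f n a) (hg : Lim g n b) :
    Lim (fun τ => f τ + g τ) n (a + b) := by
  refine (Tendsto.add hf hg).congr fun τ => ?_
  ring

theorem Lim.neg {f : ℂ → ℂ} {n : ℤ} {a : ℂ} (hf : Lim f n a) :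
    Lim (fun τ => - f τ) n (-a) := by
  refine (Tendsto.neg hf).congr fun τ => ?_
  ring

theorem Lim.sub {f g : ℂ → ℂ} {n : ℤ} {a b : ℂ} (hf : Lim f n a) (hg : Lim g n b) :
    Lim (fun τ => f τ - g τ) n (a - b) := by
  refine (Tendsto.sub hf hg).congr fun τ => ?_
  ring

theorem Lim.smul {f : ℂ → ℂ} {n : ℤ} {a : ℂ} (c : ℂ) (hf : Lim f n a) :
    Lim (fun τ => c * f τ) n (c * a) := by
  refine (Tendsto.const_mul c hf).congr fun τ => ?_
  ring

theorem Lim.const (c : ℂ) : Lim (fun _ => c) 0 c := by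
  simp [Lim]

theorem Lim.mul {f g : ℂ → ℂ} {n m : ℤ} {a b : ℂ} (hf : Lim f n a) (hg : Lim g m b) :
    Lim (fun τ => f τ * g τ) (n + m) (a * b) := by
  refine (Tendsto.mul hf hg).congr' ?_
  filter_upwards [self_mem_nhdsWithin] with τ hτ
  rw [zpow_add₀ hτ]
  ring

theorem Lim.inv {f : ℂ → ℂ} {n : ℤ} {a : ℂ} (hf : Lim f n a) (ha : a ≠ 0) :
    Lim (fun τ => (f τ)⁻¹) (-n) a⁻¹ := by
  refine (Tendsto.inv₀ hf ha).congr fun τ => ?_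
  rw [mul_inv, zpow_neg]

theorem Lim.pow_lim {n : ℤ} (hn : 0 < n) : Tendsto (fun τ : ℂ => τ ^ n) (𝓝[≠] 0) (𝓝 0) := by
  lift n to ℕ using hn.le
  have : Tendsto (fun τ : ℂ => τ ^ n) (𝓝 0) (𝓝 (0 ^ n)) := (continuous_pow n).tendsto 0
  rw [zero_pow (by omega)] at this
  simpa using this.mono_left nhdsWithin_le_nhds

theorem Lim.lift {f : ℂ → ℂ} {n m : ℤ} {a : ℂ} (hf : Lim f n a) (h : n < m) : Lim f m 0 := by
  have h1 := Lim.pow_lim (n := m - n) (by omega)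
  have := Tendsto.mul h1 hf
  rw [zero_mul] at this
  refine this.congr' ?_
  filter_upwards [self_mem_nhdsWithin] with τ hτ
  rw [← mul_assoc, ← zpow_add₀ hτ]
  congr 2
  ring

theorem Lim.lift_le {f : ℂ → ℂ} {n m : ℤ} {a : ℂ} (hf : Lim f n a) (h : n ≤ m) : ∃ b, Lim f m b := by
  rcases h.eq_or_lt with rfl | h
  · exact ⟨a, hf⟩
  · exact ⟨0, hf.lift h⟩

theorem Lim.unique {f g : ℂ → ℂ} {n : ℤ} {a b : ℂ} (hf : Lim f n a) (hg : Lim g n b)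
    (h : ∀ᶠ τ in 𝓝[≠] (0:ℂ), f τ = g τ) : a = b :=
  tendsto_nhds_unique (hf.congr h) hg

/-- divide: if `f * g` and `f` have known leading terms, so does `g`. -/
theorem Lim.div_left {f g : ℂ → ℂ} {n m : ℤ} {a b : ℂ} (hf : Lim f n a) (ha : a ≠ 0)
    (hfg : Lim (fun τ => f τ * g τ) m b) : Lim g (m - n) (b / a) := by
  have h1 := (hf.inv ha).mul hfg
  have hne : ∀ᶠ τ in 𝓝[≠] (0:ℂ), f τ ≠ 0 := by
    have : ∀ᶠ τ in 𝓝[≠] (0:ℂ), τ ^ n * f τ ≠ 0 := hf.eventually_ne ha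
    filter_upwards [this] with τ hτ h0
    exact hτ (by rw [h0, mul_zero])
  refine (h1.cast (m := m - n) (b := b / a) (by ring) (by field_simp)).congr ?_
  filter_upwards [hne] with τ hτ
  field_simp

theorem lim_of_analytic {h : ℂ → ℂ} (hh : AnalyticAt ℂ h 0) : Tendsto h (𝓝[≠] 0) (𝓝 (h 0)) :=
  hh.continuousAt.tendsto.mono_left nhdsWithin_le_nhds

theorem Lim.analytic_rep {f : ℂ → ℂ} {n : ℤ} {a : ℂ} (hm : MeromorphicAt f 0) (hf : Lim f n a) :
    ∃ h : ℂ → ℂ, AnalyticAt ℂ h 0 ∧ h 0 = a ∧ ∀ᶠ τ in 𝓝[≠] (0:ℂ), f τ = τ ^ (-n) * h τ := by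
  have hm' : MeromorphicAt (fun τ : ℂ => τ ^ n * f τ) 0 := ((MeromorphicAt.id 0).zpow n).mul hm
  have h0 := (tendsto_nhds_iff_meromorphicOrderAt_nonneg hm').1 ⟨a, hf⟩
  obtain ⟨h, hh, he⟩ := (MeromorphicAt.meromorphicOrderAt_nonneg_iff hm').1 h0
  refine ⟨h, hh, ?_, ?_⟩
  · exact tendsto_nhds_unique (lim_of_analytic hh) (Tendsto.congr' he hf)
  · filter_upwards [he, self_mem_nhdsWithin] with τ hτ h0
    rw [← hτ, ← mul_assoc, ← zpow_add₀ h0]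
    simp

theorem Lim.deriv_aux {f : ℂ → ℂ} {n : ℤ} {h : ℂ → ℂ} (hh : AnalyticAt ℂ h 0)
    (he : ∀ᶠ τ in 𝓝[≠] (0:ℂ), f τ = τ ^ (-n) * h τ) :
    ∀ᶠ τ in 𝓝[≠] (0:ℂ), deriv f τ = (-n : ℂ) * τ ^ (-n-1) * h τ + τ ^ (-n) * deriv h τ := by
  have e1 : ∀ᶠ τ in 𝓝[≠] (0:ℂ), ∀ᶠ σ in 𝓝 τ, f σ = σ ^ (-n) * h σ := by
    rw [eventually_nhdsWithin_iff] at he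
    rw [← eventually_eventually_nhds] at he
    rw [eventually_nhdsWithin_iff]
    filter_upwards [he] with τ hτ h0
    filter_upwards [hτ, isOpen_compl_singleton.mem_nhds h0] with σ h1 h2
    exact h1 h2
  have e2 : ∀ᶠ τ in 𝓝[≠] (0:ℂ), AnalyticAt ℂ h τ :=
    hh.eventually_analyticAt.filter_mono nhdsWithin_le_nhds
  filter_upwards [e1, e2, self_mem_nhdsWithin] with τ h1 h2 h3
  rw [Filter.EventuallyEq.deriv_eq (f := fun σ => σ ^ (-n) * h σ) h1]
  have := (hasDerivAt_zpow (-n) τ (Or.inl h3)).mul h2.differentiableAt.hasDerivAt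
  rw [show (fun σ => σ ^ (-n) * h σ) = (fun σ => σ ^ (-n)) * h from rfl, this.deriv]
  push_cast
  ring

theorem Lim.deriv {f : ℂ → ℂ} {n : ℤ} {a : ℂ} (hm : MeromorphicAt f 0) (hf : Lim f n a) :
    Lim (deriv f) (n + 1) (-n * a) := by
  obtain ⟨h, hh, h0, he⟩ := hf.analytic_rep hm
  have hd := Lim.deriv_aux hh he
  have t1 := lim_of_analytic hh
  have t2 := lim_of_analytic hh.deriv
  have t3 : Tendsto (fun τ : ℂ => τ) (𝓝[≠] 0) (𝓝 0) := tendsto_id.mono_left nhdsWithin_le_nhds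
  have := (t1.const_mul (-n : ℂ)).add (t3.mul t2)
  rw [h0, zero_mul, add_zero] at this
  refine this.congr' ?_
  filter_upwards [hd, self_mem_nhdsWithin] with τ h1 h2
  have h2' : τ ≠ 0 := h2
  rw [h1, zpow_sub₀ h2', zpow_add₀ h2', zpow_neg]
  have := zpow_ne_zero n h2'
  field_simp

theorem Lim.deriv_zero {f : ℂ → ℂ} {a : ℂ} (hm : MeromorphicAt f 0) (hf : Lim f 0 a) :
    ∃ b, Lim (_root_.deriv f) 0 b := by
  obtain ⟨h, hh, h0, he⟩ := hf.analytic_rep hm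
  have hd := Lim.deriv_aux hh he
  refine ⟨_, Tendsto.congr' ?_ (lim_of_analytic hh.deriv)⟩
  filter_upwards [hd] with τ h1
  rw [h1]; simp

theorem Lim.step {f : ℂ → ℂ} (hm : MeromorphicAt f 0) (hf : Lim f 0 0) : ∃ b, Lim f (-1) b := by
  obtain ⟨h, hh, h0, he⟩ := hf.analytic_rep hm
  have := hh.differentiableAt.hasDerivAt
  rw [hasDerivAt_iff_tendsto_slope] at this
  refine ⟨_, this.congr' ?_⟩
  filter_upwards [he] with τ h1
  rw [h1, slope_def_field, h0]
  simp
  ring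

theorem Lim.lead {f : ℂ → ℂ} (hm : MeromorphicAt f 0) :
    (∀ᶠ τ in 𝓝[≠] (0:ℂ), f τ = 0) ∨ ∃ (n : ℤ) (a : ℂ), a ≠ 0 ∧ Lim f n a := by
  by_cases ht : meromorphicOrderAt f 0 = ⊤
  · exact Or.inl (meromorphicOrderAt_eq_top_iff.1 ht)
  · right
    obtain ⟨n, hn⟩ := WithTop.ne_top_iff_exists.1 ht
    obtain ⟨g, hg, hg0, he⟩ := (meromorphicOrderAt_eq_int_iff hm).1 hn.symm
    refine ⟨-n, g 0, hg0, (lim_of_analytic hg).congr' ?_⟩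
    filter_upwards [he, self_mem_nhdsWithin] with τ h1 h2
    rw [h1, sub_zero, smul_eq_mul, ← mul_assoc, ← zpow_add₀ h2]
    simp

theorem Lim.dich {f : ℂ → ℂ} (hm : MeromorphicAt f 0) :
    (∃ a, Lim f 0 a) ∨ ∃ (n : ℤ) (a : ℂ), 1 ≤ n ∧ a ≠ 0 ∧ Lim f n a := by
  rcases Lim.lead hm with h | ⟨n, a, ha, h⟩
  · refine Or.inl ⟨0, ((Lim.const 0)).congr ?_⟩
    filter_upwards [h] with τ h1
    rw [h1]
  · by_cases hn : 1 ≤ n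
    · exact Or.inr ⟨n, a, hn, ha, h⟩
    · exact Or.inl (h.lift_le (by omega))

theorem Lim.lim0 {f : ℂ → ℂ} {a : ℂ} (h : Lim f 0 a) : Tendsto f (𝓝[≠] 0) (𝓝 a) := by
  simpa [Lim] using h

theorem Lim.of_lim0 {f : ℂ → ℂ} {a : ℂ} (h : Tendsto f (𝓝[≠] 0) (𝓝 a)) : Lim f 0 a := by
  simpa [Lim] using h

/-- Product with a prescribed level. -/
theorem Lim.mulz {f g : ℂ → ℂ} {n m N : ℤ} {a b : ℂ} (hf : Lim f n a) (hg : Lim g m b)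
    (hN : n + m = N := by omega) :
    Lim (fun τ => f τ * g τ) N (a * b) := hN ▸ hf.mul hg

/-- Raising the level kills the leading coefficient. -/
theorem Lim.up {f : ℂ → ℂ} {n m : ℤ} {a : ℂ} (hf : Lim f n a) (h : n < m := by omega) :
    Lim f m 0 := hf.lift h

attribute [irreducible] Lim

/-- The system in the variables `x`, `v = 2y - 1`, `z`, `s = 2(y + w) - 1` near `τ = 0`. -/
structure LocSys (A B γ δ β : ℂ) (T x v z s dx dv dz ds : ℂ → ℂ) : Prop where
  mx : MeromorphicAt x 0
  mv : MeromorphicAt v 0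
  mz : MeromorphicAt z 0
  ms : MeromorphicAt s 0
  hV : ∀ᶠ τ in 𝓝[≠] (0:ℂ), dv τ = x τ * (1 - v τ * v τ) - A * v τ + β
  hZ : ∀ᶠ τ in 𝓝[≠] (0:ℂ), dz τ = z τ * z τ * s τ + B * z τ + T τ
  hX : ∀ᶠ τ in 𝓝[≠] (0:ℂ), dx τ =
    v τ * (x τ * x τ - z τ * z τ) + z τ * z τ * s τ + A * x τ + γ * z τ + T τ
  hS : ∀ᶠ τ in 𝓝[≠] (0:ℂ), ds τ =
    - (z τ * (s τ * s τ)) + (x τ - z τ) * (1 - v τ * v τ) + z τ - B * s τ + δ * v τ + β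

namespace LocSys

variable {A B γ δ β : ℂ} {T x v z s dx dv dz ds : ℂ → ℂ}

/-- The `x`-equation with `z ^ 2 * s` eliminated. -/
theorem hX' (h : LocSys A B γ δ β T x v z s dx dv dz ds) :
    ∀ᶠ τ in 𝓝[≠] (0:ℂ), dx τ =
      v τ * (x τ * x τ - z τ * z τ) + dz τ + A * x τ + (γ - B) * z τ := by
  filter_upwards [h.hX, h.hZ] with τ h1 h2
  rw [h1, h2]; ring

/-- Common consequences of a pole of `x`: `v` is regular with value `±1`. -/
theorem v_reg (h : LocSys A B γ δ β T x v z s dx dv dz ds)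
    (hdv : ∀ n a, Lim v n a → ∃ b, Lim dv (n + 1) b)
    (hdv0 : ∀ a, Lim v 0 a → ∃ b, Lim dv 0 b)
    {r : ℤ} {ρ : ℂ} (hr : 1 ≤ r) (hρ : ρ ≠ 0) (hx : Lim x r ρ) :
    ∃ ε C, ε * ε = 1 ∧ Lim v 0 ε ∧ Lim (fun τ => 1 - v τ * v τ) (-r) C := by
  rcases Lim.dich h.mv with ⟨ε, hv⟩ | ⟨m, μ, hm, hμ, hv⟩
  · obtain ⟨b, hb⟩ := hdv0 ε hv
    have h1 : Lim (fun τ => 1 - v τ * v τ) 0 (1 - ε * ε) := (Lim.const 1).sub (hv.mulz hv)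
    have h2 : Lim (fun τ => x τ * (1 - v τ * v τ)) 0 (b + A * ε - β) := by
      refine Lim.congr ((hb.add (hv.smul A)).sub (Lim.const β)) ?_
      filter_upwards [h.hV] with τ h1
      rw [h1]; ring
    have h3 := hx.mulz h1 (N := r)
    have h4 := h3.unique (h2.lift (by omega : 0 < r)) (by simp)
    have h5 : 1 - ε * ε = 0 := (mul_eq_zero.1 h4).resolve_left hρ
    have h6 := hx.div_left hρ h2
    exact ⟨ε, _, by linear_combination -h5, hv, h6.cast (by ring) rfl⟩
  · exfalso
    obtain ⟨b, hb⟩ := hdv m μ hv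
    have h1 : Lim (fun τ => 1 - v τ * v τ) (m + m) (0 - μ * μ) :=
      (Lim.const 1).up.sub (hv.mul hv)
    have h2 := ((hx.mulz h1 (N := r + (m + m))).sub (hv.smul A).up).add (Lim.const β).up
    have h3 := hb.up.unique h2 h.hV
    have : ρ * (μ * μ) = 0 := by linear_combination h3
    simp [hρ, hμ] at this

/-- If `x` and `z` have poles of different (large) orders we get a contradiction. -/
theorem same_order (h : LocSys A B γ δ β T x v z s dx dv dz ds)
    {r k : ℤ} {ρ ζ ε b d : ℂ} (hr : 1 ≤ r) (hk : 1 ≤ k) (hρ : ρ ≠ 0) (hζ : ζ ≠ 0) (hε : ε ≠ 0)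
    (hx : Lim x r ρ) (hz : Lim z k ζ) (hv : Lim v 0 ε)
    (hdx : Lim dx (r + 1) b) (hdz : Lim dz (k + 1) d) : r = k := by
  rcases lt_trichotomy r k with hlt | heq | hgt
  · exfalso
    have hh := hdx.up.unique (((hv.mulz ((hx.mul hx).up.sub (hz.mul hz))).add
      hdz.up).add (hx.smul A).up |>.add ((hz.smul (γ - B)).up (m := k + k))) h.hX'
    have : ε * (ζ * ζ) = 0 := by linear_combination hh
    simp [hε, hζ] at this
  · exact heq
  · exfalso
    have hh := hdx.up.unique (((hv.mulz ((hx.mul hx).sub (hz.mul hz).up)).add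
      hdz.up).add (hx.smul A).up |>.add ((hz.smul (γ - B)).up (m := r + r))) h.hX'
    have : ε * (ρ * ρ) = 0 := by linear_combination -hh
    simp [hε, hρ] at this

/-- At `t = 0` and `t = ∞`, the function `x` is regular. -/
theorem x_reg (h : LocSys A B γ δ β T x v z s dx dv dz ds)
    (hdx : ∀ n a, Lim x n a → ∃ b, Lim dx n b)
    (hdv : ∀ n a, Lim v n a → ∃ b, Lim dv n b)
    (hdz : ∀ n a, Lim z n a → ∃ b, Lim dz n b)
    (hds : ∀ n a, Lim s n a → ∃ b, Lim ds n b)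
    {θ : ℂ} (hT : Lim T 1 θ) : ∃ a, Lim x 0 a := by
  rcases Lim.dich h.mx with hx | ⟨r, ρ, hr, hρ, hx⟩
  · exact hx
  exfalso
  have hdv' : ∀ n a, Lim v n a → ∃ b, Lim dv (n + 1) b := fun n a hn => by
    obtain ⟨b, hb⟩ := hdv n a hn
    exact ⟨0, hb.up⟩
  obtain ⟨ε, C, hε, hv, hv2⟩ := h.v_reg hdv' (hdv 0) hr hρ hx
  have hε0 : ε ≠ 0 := by rintro rfl; simp at hε
  obtain ⟨b, hb⟩ := hdx _ _ hx
  rcases Lim.dich h.mz with ⟨ζ, hz⟩ | ⟨k, ζ, hk, hζ, hz⟩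
  · obtain ⟨d, hd⟩ := hdz _ _ hz
    have hh := hb.up.unique (((hv.mulz ((hx.mul hx).sub (hz.mulz hz (N := 0)).up)).add
      hd.up).add (hx.smul A).up |>.add ((hz.smul (γ - B)).up (m := r + r))) h.hX'
    have : ε * (ρ * ρ) = 0 := by linear_combination -hh
    simp [hε0, hρ] at this
  · obtain ⟨d, hd⟩ := hdz _ _ hz
    have hrk := h.same_order hr hk hρ hζ hε0 hx hz hv hb.up hd.up
    subst hrk
    obtain ⟨θ', hT'⟩ := hT.lift_le hr
    have h1 : Lim (fun τ => z τ * z τ * s τ) r (d - B * ζ - θ') := by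
      refine Lim.congr ((hd.sub (hz.smul B)).sub hT') ?_
      filter_upwards [h.hZ] with τ h1
      rw [h1]; ring
    have hs := (hz.mul hz).div_left (mul_ne_zero hζ hζ) h1
    obtain ⟨e, he⟩ := hds _ _ hs
    have hh := he.up.unique (((((hz.mul (hs.mul hs)).up.neg.add
      ((hx.sub hz).mulz hv2 (N := 0)).up).add hz).sub (hs.smul B).up).add
        (hv.smul δ).up |>.add (Lim.const β).up) h.hS
    apply hζ
    linear_combination -hh

/-- At `t = ∞`, the function `s` is regular. -/
theorem s_reg (h : LocSys A B γ δ β T x v z s dx dv dz ds)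
    (hdx : ∀ n a, Lim x n a → ∃ b, Lim dx n b)
    (hdv : ∀ n a, Lim v n a → ∃ b, Lim dv n b)
    (hdz : ∀ n a, Lim z n a → ∃ b, Lim dz n b)
    (hds : ∀ n a, Lim s n a → ∃ b, Lim ds n b)
    (hT : Lim T 1 1) {ξ : ℂ} (hx : Lim x 0 ξ) : ∃ a, Lim s 0 a := by
  rcases Lim.dich h.ms with hs | ⟨j, σ, hj, hσ, hs⟩
  · exact hs
  exfalso
  obtain ⟨e, he⟩ := hds _ _ hs
  rcases Lim.lead h.mz with hz0 | ⟨k, ζ, hζ, hz⟩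
  · have hz : Lim z 0 0 := (Lim.const 0).congr (hz0.mono fun τ ht => ht.symm)
    have hzs : Lim (fun τ => z τ * z τ * s τ) 0 0 :=
      (Lim.const 0).congr (hz0.mono fun τ ht => by rw [ht]; ring)
    obtain ⟨d, hd⟩ := hdz _ _ hz
    have hh := hd.up.unique ((hzs.up.add (hz.smul B).up).add hT) h.hZ
    simp at hh
  obtain ⟨d, hd⟩ := hdz _ _ hz
  have hzzs := (hz.mul hz).mul hs
  have hk : k ≤ 0 := by
    by_contra hk
    have hh := hd.up.unique ((hzzs.add (hz.smul B).up).add hT.up) h.hZ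
    have : ζ * ζ * σ = 0 := by linear_combination -hh
    simp [hζ, hσ] at this
  have hkj : k + k + j = 1 := by
    rcases lt_trichotomy (k + k + j) 1 with hlt | heq | hgt
    · exfalso
      have hh := hd.up.unique ((hzzs.up.add (hz.smul B).up).add hT) h.hZ
      simp at hh
    · exact heq
    · exfalso
      have hh := hd.up.unique ((hzzs.add (hz.smul B).up).add hT.up) h.hZ
      have : ζ * ζ * σ = 0 := by linear_combination -hh
      simp [hζ, hσ] at this
  have hzss := hz.mul (hs.mul hs)
  rcases Lim.dich h.mv with ⟨ν, hv⟩ | ⟨m, μ, hm, hμ, hv⟩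
  · obtain ⟨ζ', hz'⟩ := hz.lift_le hk
    have hv2 : Lim (fun τ => 1 - v τ * v τ) 0 (1 - ν * ν) := (Lim.const 1).sub (hv.mulz hv)
    have hh := he.up.unique (((((hzss.neg.add
      ((hx.sub hz').mulz hv2 (N := 0)).up).add hz.up).sub (hs.smul B).up).add
        (hv.smul δ).up).add (Lim.const β).up) h.hS
    have : ζ * (σ * σ) = 0 := by linear_combination hh
    simp [hζ, hσ] at this
  · obtain ⟨f, hf⟩ := hdv _ _ hv
    have hxvv : Lim (fun τ => (v τ * v τ) * x τ) m (0 - f - A * μ + 0) := by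
      refine Lim.congr (((hx.up.sub hf).sub (hv.smul A)).add (Lim.const β).up) ?_
      filter_upwards [h.hV] with τ h1
      rw [h1]; ring
    have hx' := (hv.mul hv).div_left (mul_ne_zero hμ hμ) hxvv
    have hzvv := hz.mul (hv.mul hv)
    have hS' : ∀ᶠ τ in 𝓝[≠] (0:ℂ), ds τ = - (z τ * (s τ * s τ)) + z τ * (v τ * v τ)
        - (v τ * v τ) * x τ + x τ - B * s τ + δ * v τ + β := by
      filter_upwards [h.hS] with τ h1
      rw [h1]; ring
    rcases lt_trichotomy m j with hlt | heq | hgt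
    · have hh := he.up.unique (((((((hzss.neg.add hzvv.up).sub hxvv.up).add hx.up).sub
        (hs.smul B).up).add (hv.smul δ).up).add (Lim.const β).up)) hS'
      have : ζ * (σ * σ) = 0 := by linear_combination hh
      simp [hζ, hσ] at this
    · obtain ⟨b, hb⟩ := hdx _ _ hx'
      have hX'' : ∀ᶠ τ in 𝓝[≠] (0:ℂ), dx τ =
          v τ * ((x τ - z τ) * (x τ + z τ)) + dz τ + A * x τ + (γ - B) * z τ := by
        filter_upwards [h.hX'] with τ h1
        rw [h1]; ring
      have hxk : Lim x k 0 := hx'.up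
      have hh := hb.up.unique ((((hv.mul ((hxk.sub hz).mul (hxk.add hz))).add hd.up).add
        (hx'.smul A).up).add (hz.smul (γ - B)).up) hX''
      have : μ * (ζ * ζ) = 0 := by linear_combination hh
      simp [hζ, hμ] at this
    · have hh := he.up.unique (((((((hzss.up.neg.add hzvv).sub hxvv.up).add hx.up).sub
        (hs.smul B).up).add (hv.smul δ).up).add (Lim.const β).up)) hS'
      have : ζ * (μ * μ) = 0 := by linear_combination -hh
      simp [hζ, hμ] at this

/-- At a point `c ≠ 0`, `x` has at most a simple pole, with residue in `c ℤ`. -/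
theorem x_res (h : LocSys A B γ δ β T x v z s dx dv dz ds) {c : ℂ}
    (hdx : ∀ n a, Lim x n a → Lim dx (n + 1) (- n * c * a))
    (hdv : ∀ n a, Lim v n a → Lim dv (n + 1) (- n * c * a))
    (hdv0 : ∀ a, Lim v 0 a → ∃ b, Lim dv 0 b)
    (hdz : ∀ n a, Lim z n a → Lim dz (n + 1) (- n * c * a))
    (hdz0 : ∀ a, Lim z 0 a → ∃ b, Lim dz 0 b)
    (hds0 : ∀ a, Lim s 0 a → ∃ b, Lim ds 0 b)
    (hT : Lim T 0 c) : ∃ n : ℤ, Lim x 1 (n * c) := by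
  rcases Lim.dich h.mx with ⟨ξ, hx⟩ | ⟨r, ρ, hr, hρ, hx⟩
  · exact ⟨0, hx.up.cast rfl (by simp)⟩
  obtain ⟨ε, C, hε, hv, hv2⟩ := h.v_reg (fun n a hn => ⟨_, hdv n a hn⟩) hdv0 hr hρ hx
  have hε0 : ε ≠ 0 := by rintro rfl; simp at hε
  have hεn : ∃ n : ℤ, ε = n := by
    rcases mul_self_eq_one_iff.1 hε with h | h
    · exact ⟨1, by simp [h]⟩
    · exact ⟨-1, by simp [h]⟩
  obtain ⟨nε, hnε⟩ := hεn
  have hb := hdx _ _ hx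
  rcases Lim.dich h.mz with ⟨ζ, hz⟩ | ⟨k, ζ, hk, hζ, hz⟩
  · obtain ⟨d, hd⟩ := hdz0 _ hz
    have hR := ((hv.mulz ((hx.mul hx).sub (hz.mulz hz (N := 0)).up)).add
      hd.up).add (hx.smul A).up |>.add ((hz.smul (γ - B)).up (m := r + r))
    rcases hr.eq_or_lt with h1 | h1
    · subst h1
      have hh := Lim.unique (hb.cast (by norm_num) rfl) hR h.hX'
      push_cast at hh
      have h2 : ρ * (ε * ρ + c) = 0 := by linear_combination -hh
      have h3 := (mul_eq_zero.1 h2).resolve_left hρ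
      refine ⟨-nε, hx.cast rfl ?_⟩
      push_cast
      rw [← hnε]
      linear_combination ε * h3 - ρ * hε
    · exfalso
      have hh := hb.up.unique hR h.hX'
      have : ε * (ρ * ρ) = 0 := by linear_combination -hh
      simp [hε0, hρ] at this
  · have hd := hdz _ _ hz
    have hrk := h.same_order hr hk hρ hζ hε0 hx hz hv hb hd
    subst hrk
    have h1 : Lim (fun τ => z τ * z τ * s τ) (r + 1) (-r * c * ζ - 0 - 0) := by
      refine Lim.congr ((hd.sub (hz.smul B).up).sub hT.up) ?_
      filter_upwards [h.hZ] with τ h1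
      rw [h1]; ring
    have hs := (hz.mul hz).div_left (mul_ne_zero hζ hζ) h1
    rcases hr.eq_or_lt with h2 | h2
    · subst h2
      have hs0 := hs.cast (m := 0) (b := -c / ζ) (by norm_num) (by field_simp; push_cast; ring)
      obtain ⟨e, he⟩ := hds0 _ hs0
      have hh := he.up.unique (((((hz.mulz (hs0.mulz hs0 (N := 0))).neg.add
        ((hx.sub hz).mulz hv2 (N := 0)).up).add hz).sub (hs0.smul B).up).add
          (hv.smul δ).up |>.add (Lim.const β).up) h.hS
      have hX := Lim.unique (hb.cast (m := 1 + 1) rfl rfl)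
        ((((hv.mulz ((hx.mul hx).sub (hz.mul hz))).add hd).add (hx.smul A).up).add
          (hz.smul (γ - B)).up) h.hX'
      push_cast at hX
      have h3 : ζ * ζ = c * c := by
        field_simp at hh
        linear_combination -hh
      have h4 : (ρ - ζ) * (ε * (ρ + ζ) + c) = 0 := by linear_combination -hX
      have hζn : ∃ n : ℤ, ζ = n * c := by
        rcases mul_self_eq_mul_self_iff.1 h3 with h | h
        · exact ⟨1, by simp [h]⟩
        · exact ⟨-1, by simp [h]⟩
      obtain ⟨nζ, hnζ⟩ := hζn
      rcases mul_eq_zero.1 h4 with h5 | h5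
      · exact ⟨nζ, hx.cast rfl (by rw [← hnζ]; linear_combination h5)⟩
      · refine ⟨-nζ - nε, hx.cast rfl ?_⟩
        push_cast
        rw [← hnε]
        linear_combination ε * h5 - (ρ + ζ) * hε - hnζ
    · exfalso
      have hs0 : Lim s 0 0 := hs.up
      obtain ⟨e, he⟩ := hds0 _ hs0
      have hh := he.up.unique (((((hz.mul (hs.mul hs)).up.neg.add
        ((hx.sub hz).mulz hv2 (N := 0)).up).add hz).sub (hs0.smul B).up).add
          (hv.smul δ).up |>.add (Lim.const β).up) h.hS
      apply hζ
      linear_combination -hh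

end LocSys

theorem ev_shift {S : Set ℂ} (hS : S.Finite) (c : ℂ) : ∀ᶠ τ in 𝓝[≠] (0:ℂ), c + τ ∉ S := by
  have h1 : (S \ {c}).Finite := hS.sdiff
  have h2 : ∀ᶠ t in 𝓝 c, t ∉ S \ {c} := h1.isClosed.isOpen_compl.mem_nhds (by simp)
  have h3 : Tendsto (fun τ : ℂ => c + τ) (𝓝 0) (𝓝 c) := by
    have : Continuous (fun τ : ℂ => c + τ) := by fun_prop
    simpa using this.tendsto 0
  filter_upwards [(h3.eventually h2).filter_mono nhdsWithin_le_nhds, self_mem_nhdsWithin] with τ h4 h5 h6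
  exact h4 ⟨h6, by simpa using h5⟩

theorem ev_inv {S : Set ℂ} (hS : S.Finite) : ∀ᶠ τ in 𝓝[≠] (0:ℂ), τ⁻¹ ∉ S :=
  (tendsto_inv₀_nhdsNE_zero (α := ℂ)).eventually hS.isBounded

theorem tendsto_atInfty {F : ℂ → ℂ} {l : Filter ℂ} (h : Tendsto (fun τ => F τ⁻¹) (𝓝[≠] 0) l) :
    Tendsto F atInfty l := by
  have h1 : atInfty = Bornology.cobounded ℂ := comap_norm_atTop
  rw [h1]
  have := h.comp (tendsto_inv₀_cobounded' (α := ℂ))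
  simpa [Function.comp_def] using this

theorem atInfty_inv : Tendsto (fun τ : ℂ => τ⁻¹) (𝓝[≠] 0) atInfty := by
  have h1 : atInfty = Bornology.cobounded ℂ := comap_norm_atTop
  rw [h1]
  exact tendsto_inv₀_nhdsNE_zero

theorem tendsto_shift {F : ℂ → ℂ} {l : Filter ℂ} {c : ℂ}
    (h : Tendsto (fun τ => F (c + τ)) (𝓝[≠] 0) l) : Tendsto F (𝓝[≠] c) l := by
  have h3 : Tendsto (fun t : ℂ => t - c) (𝓝[≠] c) (𝓝[≠] 0) := by
    refine tendsto_nhdsWithin_iff.2 ⟨?_, ?_⟩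
    · have : Continuous (fun t : ℂ => t - c) := by fun_prop
      simpa using (this.tendsto c).mono_left nhdsWithin_le_nhds
    · filter_upwards [self_mem_nhdsWithin] with t ht
      simpa [sub_eq_zero] using ht
  have := h.comp h3
  simpa [Function.comp_def] using this

theorem analytic_poly_shift (p : Polynomial ℂ) (c : ℂ) :
    AnalyticAt ℂ (fun τ => p.eval (c + τ)) 0 := by
  have h : Differentiable ℂ (fun τ : ℂ => p.eval (c + τ)) :=
    p.differentiable.comp (differentiable_id.const_add c)
  exact h.analyticAt 0

theorem IsRatFn.mero_shift {f : ℂ → ℂ} (hf : IsRatFn f) (c : ℂ) :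
    MeromorphicAt (fun τ => f (c + τ)) 0 := by
  obtain ⟨p, q, hq, h⟩ := hf
  have : (fun τ => f (c + τ)) = (fun τ => p.eval (c + τ)) / (fun τ => q.eval (c + τ)) := by
    funext τ; simp [h]
  rw [this]
  exact (analytic_poly_shift p c).meromorphicAt.div (analytic_poly_shift q c).meromorphicAt

theorem mero_poly_inv (p : Polynomial ℂ) : MeromorphicAt (fun τ : ℂ => p.eval τ⁻¹) 0 := by
  induction p using Polynomial.induction_on' with
  | add p q hp hq => simpa [Pi.add_def] using hp.add hq
  | monomial n a =>
    simp only [Polynomial.eval_monomial]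
    exact (MeromorphicAt.const a 0).mul ((MeromorphicAt.id 0).inv.pow n)

theorem IsRatFn.mero_inv {f : ℂ → ℂ} (hf : IsRatFn f) : MeromorphicAt (fun τ => f τ⁻¹) 0 := by
  obtain ⟨p, q, hq, h⟩ := hf
  have : (fun τ => f τ⁻¹) = (fun τ => p.eval τ⁻¹) / (fun τ => q.eval τ⁻¹) := by
    funext τ; simp [h]
  rw [this]
  exact (mero_poly_inv p).div (mero_poly_inv q)

theorem poly_zeros_finite {q : Polynomial ℂ} (hq : q ≠ 0) : {t : ℂ | q.eval t = 0}.Finite := by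
  refine (q.roots.toFinset.finite_toSet).subset fun t ht => ?_
  simp only [Finset.mem_coe, Multiset.mem_toFinset]
  exact (Polynomial.mem_roots hq).2 ht

theorem IsRatFn.diff {f : ℂ → ℂ} (hf : IsRatFn f) :
    ∃ S : Set ℂ, S.Finite ∧ ∀ t ∉ S, DifferentiableAt ℂ f t := by
  obtain ⟨p, q, hq, h⟩ := hf
  refine ⟨_, poly_zeros_finite hq, fun t ht => ?_⟩
  have : f = fun t => p.eval t / q.eval t := funext h
  rw [this]
  exact p.differentiable.differentiableAt.div q.differentiable.differentiableAt ht

theorem IsRatFn.deriv_inv {f : ℂ → ℂ} (hf : IsRatFn f) :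
    ∀ᶠ τ in 𝓝[≠] (0:ℂ), -τ * deriv (fun τ => f τ⁻¹) τ = τ⁻¹ * deriv f τ⁻¹ := by
  obtain ⟨S, hS, hd⟩ := hf.diff
  filter_upwards [ev_inv hS, self_mem_nhdsWithin] with τ h1 h2
  have h2' : τ ≠ 0 := h2
  have h3 := (hd _ h1).hasDerivAt.comp τ (hasDerivAt_inv h2')
  rw [show (fun τ => f τ⁻¹) = f ∘ Inv.inv from rfl, h3.deriv]
  field_simp

theorem mero_diff {f : ℂ → ℂ} (hf : MeromorphicAt f 0) :
    ∀ᶠ τ in 𝓝[≠] (0:ℂ), DifferentiableAt ℂ f τ :=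
  hf.eventually_analyticAt.mono fun _ h => h.differentiableAt

/-- Passing to the new variables. -/
theorem mkLoc {a1 a2 a3 a4 : ℂ} {E T X Y Z W : ℂ → ℂ}
    (mX : MeromorphicAt X 0) (mY : MeromorphicAt Y 0) (mZ : MeromorphicAt Z 0)
    (mW : MeromorphicAt W 0)
    (h : ∀ᶠ τ in 𝓝[≠] (0:ℂ),
      (E τ * deriv X τ =
          2 * X τ ^ 2 * Y τ - X τ ^ 2 + (1 - 2*a2 - 2*a3 - 2*a4) * X τ
            + 2 * a3 * Z τ + 2 * Z τ ^ 2 * W τ + T τ) ∧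
      (E τ * deriv Y τ =
          -2 * X τ * Y τ ^ 2 + 2 * X τ * Y τ - (1 - 2*a2 - 2*a3 - 2*a4) * Y τ + a1) ∧
      (E τ * deriv Z τ =
          2 * Z τ ^ 2 * W τ - Z τ ^ 2 + (1 - 2*a4) * Z τ + 2 * Y τ * Z τ ^ 2 + T τ) ∧
      (E τ * deriv W τ =
          -2 * Z τ * W τ ^ 2 + 2 * Z τ * W τ - (1 - 2*a4) * W τ
            - 2 * a3 * Y τ - 4 * Y τ * Z τ * W τ + a3)) :
    LocSys (1 - 2*a2 - 2*a3 - 2*a4) (1 - 2*a4) (2*a3) (2*a2) (2*a1 - (1 - 2*a2 - 2*a3 - 2*a4))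
      T X (fun τ => 2 * Y τ - 1) Z (fun τ => 2 * (Y τ + W τ) - 1)
      (fun τ => E τ * deriv X τ) (fun τ => E τ * deriv (fun τ => 2 * Y τ - 1) τ)
      (fun τ => E τ * deriv Z τ) (fun τ => E τ * deriv (fun τ => 2 * (Y τ + W τ) - 1) τ) := by
  have hv : ∀ᶠ τ in 𝓝[≠] (0:ℂ), deriv (fun τ => 2 * Y τ - 1) τ = 2 * deriv Y τ := by
    filter_upwards [mero_diff mY] with τ h1
    exact ((h1.hasDerivAt.const_mul 2).sub_const 1).deriv
  have hs : ∀ᶠ τ in 𝓝[≠] (0:ℂ),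
      deriv (fun τ => 2 * (Y τ + W τ) - 1) τ = 2 * (deriv Y τ + deriv W τ) := by
    filter_upwards [mero_diff mY, mero_diff mW] with τ h1 h2
    exact (((h1.hasDerivAt.add h2.hasDerivAt).const_mul 2).sub_const 1).deriv
  refine ⟨mX, ((MeromorphicAt.const 2 0).mul mY).sub (MeromorphicAt.const 1 0), mZ,
    ((MeromorphicAt.const 2 0).mul (mY.add mW)).sub (MeromorphicAt.const 1 0), ?_, ?_, ?_, ?_⟩
  · filter_upwards [h, hv] with τ h1 h2
    obtain ⟨e1, e2, e3, e4⟩ := h1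
    rw [h2]
    linear_combination 2 * e2
  · filter_upwards [h] with τ h1
    obtain ⟨e1, e2, e3, e4⟩ := h1
    linear_combination e3
  · filter_upwards [h] with τ h1
    obtain ⟨e1, e2, e3, e4⟩ := h1
    linear_combination e1
  · filter_upwards [h, hs] with τ h1 h2
    obtain ⟨e1, e2, e3, e4⟩ := h1
    rw [h2]
    linear_combination 2 * e2 + 2 * e4

theorem Lim.kind0 {f : ℂ → ℂ} (κ : ℂ) (hm : MeromorphicAt f 0) (n : ℤ) (a : ℂ) (h : Lim f n a) :
    ∃ b, Lim (fun τ => (κ * τ) * _root_.deriv f τ) n b := by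
  have h1 : Lim (fun τ => κ * τ) (-1) κ := by
    unfold Lim
    refine tendsto_const_nhds.congr' ?_
    filter_upwards [self_mem_nhdsWithin] with τ h2
    have h2' : τ ≠ 0 := h2
    rw [zpow_neg_one]; field_simp
  exact ⟨_, h1.mulz (h.deriv hm)⟩

theorem lim_shift (c : ℂ) : Lim (fun τ => c + τ) 0 c := by
  apply Lim.of_lim0
  have : Continuous (fun τ : ℂ => c + τ) := by fun_prop
  simpa using (this.tendsto 0).mono_left (nhdsWithin_le_nhds (s := {0}ᶜ))

theorem Lim.kindc {f : ℂ → ℂ} (c : ℂ) (hm : MeromorphicAt f 0) (n : ℤ) (a : ℂ) (h : Lim f n a) :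
    Lim (fun τ => (c + τ) * _root_.deriv f τ) (n + 1) (-n * c * a) :=
  ((lim_shift c).mulz (h.deriv hm)).cast rfl (by ring)

theorem Lim.kindc0 {f : ℂ → ℂ} (c : ℂ) (hm : MeromorphicAt f 0) (a : ℂ) (h : Lim f 0 a) :
    ∃ b, Lim (fun τ => (c + τ) * _root_.deriv f τ) 0 b := by
  obtain ⟨b, hb⟩ := h.deriv_zero hm
  exact ⟨_, (lim_shift c).mulz hb⟩

/-- If `h' = -τ⁻² g` near `0` and `g → M`, then `(g - M) / τ → 0`. -/
theorem no_residue {k g : ℂ → ℂ} {M : ℂ} (mk : MeromorphicAt k 0) (mg : MeromorphicAt g 0)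
    (hg : Lim g 0 M) (hd : ∀ᶠ τ in 𝓝[≠] (0:ℂ), deriv k τ = - (τ ^ (-2 : ℤ) * g τ)) :
    Lim (fun τ => g τ - M) (-1) 0 := by
  have mg' : MeromorphicAt (fun τ => g τ - M) 0 := mg.sub (MeromorphicAt.const M 0)
  obtain ⟨b, hb⟩ := Lim.step mg' ((hg.sub (Lim.const M)).cast rfl (sub_self M))
  have mK : MeromorphicAt (fun τ => k τ - M * τ⁻¹) 0 :=
    mk.sub ((MeromorphicAt.const M 0).mul (MeromorphicAt.id 0).inv)
  have hK : ∀ᶠ τ in 𝓝[≠] (0:ℂ), -(τ ^ (-2 : ℤ) * (g τ - M)) = deriv (fun τ => k τ - M * τ⁻¹) τ := by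
    filter_upwards [hd, mero_diff mk, self_mem_nhdsWithin] with τ h1 h2 h3
    have h3' : τ ≠ 0 := h3
    have := (h2.hasDerivAt.sub ((hasDerivAt_inv h3').const_mul M)).deriv
    rw [show (fun τ => k τ - M * τ⁻¹) = k - fun y => M * y⁻¹ from rfl, this, h1]
    rw [zpow_neg]
    norm_cast
    ring
  have hp : Lim (fun τ => τ ^ (-2 : ℤ)) 2 1 := by
    unfold Lim
    refine tendsto_const_nhds.congr' ?_
    filter_upwards [self_mem_nhdsWithin] with τ h2
    rw [← zpow_add₀ h2]; simp
  have hK1 := ((hp.mulz hb (N := 1)).neg).congr hK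
  have : b = 0 := by
    rcases Lim.dich mK with ⟨a, ha⟩ | ⟨n, a, hn, ha, hl⟩
    · obtain ⟨d, hd⟩ := ha.deriv_zero mK
      have := hK1.unique hd.up (by simp)
      linear_combination -this
    · have h1 := hl.deriv mK
      have := (hK1.up (m := n + 1)).unique h1 (by simp)
      have hn' : (n : ℂ) ≠ 0 := by exact_mod_cast (by omega : n ≠ 0)
      exfalso
      simp [hn', ha] at this
  rwa [this] at hb

/-- Rational up to a finite set. -/
def RatAE (g : ℂ → ℂ) : Prop :=
  ∃ p q : Polynomial ℂ, q ≠ 0 ∧ ∀ᶠ t in cofinite, q.eval t * g t = p.eval t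

theorem RatAE.sub {f g : ℂ → ℂ} (hf : RatAE f) (hg : RatAE g) : RatAE (fun t => f t - g t) := by
  obtain ⟨p, q, hq, h⟩ := hf
  obtain ⟨p', q', hq', h'⟩ := hg
  refine ⟨q' * p - q * p', q * q', mul_ne_zero hq hq', ?_⟩
  filter_upwards [h, h'] with t h1 h2
  simp only [Polynomial.eval_sub, Polynomial.eval_mul]
  linear_combination q'.eval t * h1 - q.eval t * h2

theorem RatAE.of_rat {f : ℂ → ℂ} (hf : IsRatFn f) : RatAE f := by
  obtain ⟨p, q, hq, h⟩ := hf
  refine ⟨p, q, hq, ?_⟩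
  filter_upwards [(poly_zeros_finite hq).compl_mem_cofinite] with t ht
  have ht' : q.eval t ≠ 0 := ht
  rw [h]; field_simp

theorem ratAE_sum (P : Finset ℂ) (ρ : ℂ → ℂ) : RatAE (fun t => ∑ c ∈ P, ρ c / (t - c)) := by
  classical
  induction P using Finset.induction_on with
  | empty => exact ⟨0, 1, one_ne_zero, by simp⟩
  | insert c P hc ih =>
    have h1 : RatAE (fun t => - ρ c / (t - c)) := by
      refine ⟨Polynomial.C (-ρ c), Polynomial.X - Polynomial.C c, Polynomial.X_sub_C_ne_zero c, ?_⟩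
      filter_upwards [(Set.finite_singleton c).compl_mem_cofinite] with t ht
      have : t - c ≠ 0 := sub_ne_zero.2 (by simpa using ht)
      simp; field_simp
    have := ih.sub h1
    have he : (fun t => ∑ c ∈ insert c P, ρ c / (t - c)) =
        fun t => ∑ c ∈ P, ρ c / (t - c) - - ρ c / (t - c) := by
      funext t
      rw [Finset.sum_insert hc]; ring
    rw [he]
    exact this

theorem punctured_le_cofinite (c : ℂ) : 𝓝[≠] c ≤ cofinite := by
  refine le_cofinite_iff_eventually_ne.2 fun t => ?_
  by_cases h : t = c
  · subst h
    exact self_mem_nhdsWithin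
  · exact eventually_nhdsWithin_of_eventually_nhds (isOpen_compl_singleton.mem_nhds (Ne.symm h))

theorem atInfty_le_cofinite : atInfty ≤ cofinite := by
  have h1 : atInfty = Bornology.cobounded ℂ := comap_norm_atTop
  rw [h1]
  exact le_cofinite_iff_eventually_ne.2 fun t => (Bornology.isBounded_singleton (x := t))

theorem ratAE_poly (n : ℕ) {g : ℂ → ℂ} (hr : ∀ c, ∃ l, Tendsto g (𝓝[≠] c) (𝓝 l))
    (p q : Polynomial ℂ) (hq : q ≠ 0) (hn : q.natDegree = n)
    (h : ∀ᶠ t in cofinite, q.eval t * g t = p.eval t) :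
    ∃ P : Polynomial ℂ, ∀ᶠ t in cofinite, g t = P.eval t := by
  induction n generalizing p q with
  | zero =>
    rw [Polynomial.natDegree_eq_zero] at hn
    obtain ⟨a, rfl⟩ := hn
    have ha : a ≠ 0 := by rintro rfl; simp at hq
    refine ⟨Polynomial.C a⁻¹ * p, ?_⟩
    filter_upwards [h] with t ht
    simp only [Polynomial.eval_mul, Polynomial.eval_C] at ht ⊢
    rw [← ht]; field_simp
  | succ n ih =>
    obtain ⟨c, hc⟩ := Complex.exists_root (f := q) (by
      rw [Polynomial.degree_eq_natDegree hq, hn]; exact_mod_cast Nat.succ_pos n)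
    have hpc : p.eval c = 0 := by
      obtain ⟨l, hl⟩ := hr c
      have h1 : Tendsto (fun t => q.eval t * g t) (𝓝[≠] c) (𝓝 (q.eval c * l)) :=
        ((q.continuous.tendsto c).mono_left nhdsWithin_le_nhds).mul hl
      have h2 : Tendsto (fun t => p.eval t) (𝓝[≠] c) (𝓝 (p.eval c)) :=
        (p.continuous.tendsto c).mono_left nhdsWithin_le_nhds
      have h3 := tendsto_nhds_unique (h1.congr' (punctured_le_cofinite c h)) h2
      rw [← h3, hc.eq_zero, zero_mul]
    obtain ⟨q1, rfl⟩ := Polynomial.dvd_iff_isRoot.2 hc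
    obtain ⟨p1, rfl⟩ := Polynomial.dvd_iff_isRoot.2 (hpc : p.IsRoot c)
    have hq1 : q1 ≠ 0 := right_ne_zero_of_mul hq
    refine ih p1 q1 hq1 ?_ ?_
    · rw [Polynomial.natDegree_mul (Polynomial.X_sub_C_ne_zero c) hq1,
        Polynomial.natDegree_X_sub_C] at hn
      omega
    · filter_upwards [h, (Set.finite_singleton c).compl_mem_cofinite] with t h1 h2
      have h3 : t - c ≠ 0 := sub_ne_zero.2 (by simpa using h2)
      simp only [Polynomial.eval_mul, Polynomial.eval_sub, Polynomial.eval_X, Polynomial.eval_C] at h1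
      apply mul_left_cancel₀ h3
      linear_combination h1

instance atInfty_neBot : NeBot atInfty := by
  have h1 : atInfty = Bornology.cobounded ℂ := comap_norm_atTop
  rw [h1]
  infer_instance

/-- A rational function without poles, bounded at infinity, is constant. -/
theorem RatAE.const {g : ℂ → ℂ} (hg : RatAE g) {L : ℂ} (hL : Tendsto g atInfty (𝓝 L))
    (hr : ∀ c, ∃ l, Tendsto g (𝓝[≠] c) (𝓝 l)) : ∀ᶠ t in cofinite, g t = L := by
  obtain ⟨p, q, hq, h⟩ := hg
  obtain ⟨P, hP⟩ := ratAE_poly _ hr p q hq rfl h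
  have h1 : Tendsto (fun t => P.eval t) atInfty (𝓝 L) := hL.congr' (atInfty_le_cofinite hP)
  have h2 : P.degree ≤ 0 := by
    by_contra hd
    have := P.tendsto_norm_atTop (l := atInfty) (z := id) (not_le.1 hd) tendsto_comap
    exact not_tendsto_atTop_of_tendsto_nhds h1.norm this
  rw [Polynomial.eq_C_of_degree_le_zero h2] at h1 hP
  simp only [Polynomial.eval_C] at h1 hP
  have := tendsto_nhds_unique h1 tendsto_const_nhds
  rw [this]
  exact hP

theorem lim_sum (P : Finset ℂ) (f : ℂ → ℂ → ℂ) (n : ℤ) (a : ℂ → ℂ)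
    (h : ∀ c ∈ P, Lim (f c) n (a c)) : Lim (fun τ => ∑ c ∈ P, f c τ) n (∑ c ∈ P, a c) := by
  unfold Lim at *
  simp only [Finset.mul_sum]
  exact tendsto_finsetSum P h

theorem lim_reg {f : ℂ → ℂ} (hm : MeromorphicAt f 0) (h : Lim f 1 0) : ∃ a, Lim f 0 a := by
  rcases Lim.dich hm with h1 | ⟨n, a, hn, ha, hl⟩
  · exact h1
  · exfalso
    rcases hn.eq_or_lt with rfl | h2
    · exact ha (hl.unique h (by simp))
    · exact ha (hl.unique (h.up) (by simp))

/-- The residue theorem for `x / t`. -/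
theorem residue_int {x : ℂ → ℂ} (hx : IsRatFn x) {x0 L : ℂ} (h0 : Tendsto x (𝓝[≠] 0) (𝓝 x0))
    (hL : Tendsto x atInfty (𝓝 L)) (n : ℂ → ℤ)
    (hn : ∀ c, Lim (fun τ => x (c + τ)) 1 (n c * c)) : ∃ m : ℤ, L - x0 = m := by
  classical
  obtain ⟨p, q, hq, hpq⟩ := id hx
  set P := q.roots.toFinset with hP
  set ρ : ℂ → ℂ := fun c => n c * c with hρ
  have hg : RatAE (fun t => x t - ∑ c ∈ P, ρ c / (t - c)) := (RatAE.of_rat hx).sub (ratAE_sum P ρ)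
  have hgL : Tendsto (fun t => x t - ∑ c ∈ P, ρ c / (t - c)) atInfty (𝓝 L) := by
    have h1 : Tendsto (fun t => ∑ c ∈ P, ρ c / (t - c)) atInfty (𝓝 (∑ c ∈ P, 0)) := by
      refine tendsto_finsetSum P fun c _ => ?_
      apply tendsto_atInfty
      have h2 : Tendsto (fun τ : ℂ => ρ c * τ / (1 - c * τ)) (𝓝[≠] 0) (𝓝 0) := by
        have h3 : ContinuousAt (fun τ : ℂ => ρ c * τ / (1 - c * τ)) 0 := by
          refine ContinuousAt.div (by fun_prop) (by fun_prop) (by simp)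
        simpa using h3.tendsto.mono_left (nhdsWithin_le_nhds (s := {0}ᶜ))
      refine h2.congr' ?_
      filter_upwards [self_mem_nhdsWithin] with τ hτ
      have hτ' : τ ≠ 0 := hτ
      rw [show τ⁻¹ - c = (1 - c * τ) / τ by field_simp, div_div_eq_mul_div]
    simpa using hL.sub h1
  have hgr : ∀ e, ∃ l, Tendsto (fun t => x t - ∑ c ∈ P, ρ c / (t - c)) (𝓝[≠] e) (𝓝 l) := by
    intro e
    have hterm : ∀ c ∈ P, Lim (fun τ => ρ c / (e + τ - c)) 1 (if c = e then ρ e else 0) := by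
      intro c _
      split_ifs with hce
      · subst hce
        unfold Lim
        refine tendsto_const_nhds.congr' ?_
        filter_upwards [self_mem_nhdsWithin] with τ hτ
        have hτ' : τ ≠ 0 := hτ
        rw [add_sub_cancel_left]; simp; field_simp
      · have hce' : e - c ≠ 0 := sub_ne_zero.2 (Ne.symm hce)
        have h3 : ContinuousAt (fun τ : ℂ => ρ c / (e + τ - c)) 0 := by
          refine ContinuousAt.div (by fun_prop) (by fun_prop) (by simpa using hce')
        exact (Lim.of_lim0 (h3.tendsto.mono_left (nhdsWithin_le_nhds (s := {0}ᶜ)))).up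
    have hsum := (hn e).sub (lim_sum P (fun c τ => ρ c / (e + τ - c)) 1 _ hterm)
    have hz : (n e * e : ℂ) - ∑ c ∈ P, (if c = e then ρ e else 0) = 0 := by
      rw [Finset.sum_ite_eq']
      split_ifs with heP
      · simp [hρ]
      · have hqe : q.eval e ≠ 0 := by
          intro h
          exact heP (by rw [hP, Multiset.mem_toFinset]; exact (Polynomial.mem_roots hq).2 h)
        have h3 : ContinuousAt (fun τ : ℂ => x (e + τ)) 0 := by
          have : (fun τ : ℂ => x (e + τ)) = fun τ => p.eval (e + τ) / q.eval (e + τ) := by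
            funext τ; exact hpq _
          rw [this]
          exact (analytic_poly_shift p e).continuousAt.div (analytic_poly_shift q e).continuousAt
            (by simpa using hqe)
        have h4 : Lim (fun τ => x (e + τ)) 0 _ :=
          Lim.of_lim0 (h3.tendsto.mono_left (nhdsWithin_le_nhds (s := {0}ᶜ)))
        rw [(hn e).unique h4.up (by simp), sub_zero]
    rw [hz] at hsum
    have hmer : MeromorphicAt (fun τ => x (e + τ) - ∑ c ∈ P, ρ c / (e + τ - c)) 0 := by
      refine (hx.mero_shift e).sub (MeromorphicAt.fun_sum fun c _ => ?_)
      refine (MeromorphicAt.const _ 0).div ?_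
      have : AnalyticAt ℂ (fun τ : ℂ => e + τ - c) 0 := by fun_prop
      exact this.meromorphicAt
    obtain ⟨l, hl⟩ := lim_reg hmer hsum
    exact ⟨l, tendsto_shift hl.lim0⟩
  have hconst := punctured_le_cofinite 0 (hg.const hgL hgr)
  have h1 : Tendsto (fun t => x t - ∑ c ∈ P, ρ c / (t - c)) (𝓝[≠] 0)
      (𝓝 (x0 - ∑ c ∈ P, ((if c = 0 then 0 else - n c : ℤ) : ℂ))) := by
    refine h0.sub (tendsto_finsetSum P fun c _ => ?_)
    split_ifs with hc
    · subst hc; simp [hρ]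
    · have h3 : ContinuousAt (fun τ : ℂ => ρ c / (τ - c)) 0 := by
        refine ContinuousAt.div (by fun_prop) (by fun_prop) (by simpa using hc)
      have h4 := h3.tendsto.mono_left (nhdsWithin_le_nhds (s := {0}ᶜ))
      have h5 : ρ c / (0 - c) = ((- n c : ℤ) : ℂ) := by
        rw [hρ]; push_cast; field_simp; ring
      rwa [h5] at h4
  have h2 := tendsto_nhds_unique (tendsto_const_nhds.congr' (EventuallyEq.symm hconst)) h1
  refine ⟨- ∑ c ∈ P, (if c = 0 then 0 else - n c : ℤ), ?_⟩
  rw [h2]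
  push_cast
  ring

/-- For a rational solution of the Sasano system `B₄⁽¹⁾`: `x` is holomorphic at `t = 0`
with value `x₀`, has a finite limit `L` at `t = ∞`, and `L - x₀ ∈ ℤ`; moreover `y + w` is
holomorphic at `t = ∞` with limit `M` and its `1/t`-coefficient at `∞` vanishes. -/
theorem B4_rational_solution_residue_relations (a0 a1 a2 a3 a4 : ℂ)
    (hsum : a0 + a1 + 2*a2 + 2*a3 + 2*a4 = 1) (x y z w : ℂ → ℂ)
    (hsol : IsRatSolB4 a0 a1 a2 a3 a4 x y z w) :
    (∃ x0 L : ℂ, Tendsto x (𝓝[≠] 0) (𝓝 x0) ∧ Tendsto x atInfty (𝓝 L) ∧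
      ∃ n : ℤ, L - x0 = n) ∧
    (∃ M : ℂ, Tendsto (fun t => y t + w t) atInfty (𝓝 M) ∧
      Tendsto (fun t => t * (y t + w t - M)) atInfty (𝓝 0)) := by
  obtain ⟨hx, hy, hz, hw, S, hS, hE⟩ := hsol
  -- finite points
  have hloc := fun c => mkLoc (a1 := a1) (a2 := a2) (a3 := a3) (a4 := a4)
    (E := fun τ => c + τ) (T := fun τ => c + τ)
    (hx.mero_shift c) (hy.mero_shift c) (hz.mero_shift c) (hw.mero_shift c) (by
      filter_upwards [ev_shift hS c] with τ hτ
      simp only [deriv_comp_const_add]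
      exact hE _ hτ)
  -- infinity
  have hinfE : ∀ᶠ τ in 𝓝[≠] (0:ℂ), B4Eqs a0 a1 a2 a3 a4 x y z w τ⁻¹ :=
    (ev_inv hS).mono fun τ hτ => hE _ hτ
  have mX := hx.mero_inv
  have mY := hy.mero_inv
  have mZ := hz.mero_inv
  have mW := hw.mero_inv
  have hinfE' := by
    refine (?_ : ∀ᶠ τ in 𝓝[≠] (0:ℂ),
      (((-1) * τ) * deriv (fun τ => x τ⁻¹) τ =
          2 * x τ⁻¹ ^ 2 * y τ⁻¹ - x τ⁻¹ ^ 2 + (1 - 2*a2 - 2*a3 - 2*a4) * x τ⁻¹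
            + 2 * a3 * z τ⁻¹ + 2 * z τ⁻¹ ^ 2 * w τ⁻¹ + τ⁻¹) ∧
      (((-1) * τ) * deriv (fun τ => y τ⁻¹) τ =
          -2 * x τ⁻¹ * y τ⁻¹ ^ 2 + 2 * x τ⁻¹ * y τ⁻¹ - (1 - 2*a2 - 2*a3 - 2*a4) * y τ⁻¹ + a1) ∧
      (((-1) * τ) * deriv (fun τ => z τ⁻¹) τ =
          2 * z τ⁻¹ ^ 2 * w τ⁻¹ - z τ⁻¹ ^ 2 + (1 - 2*a4) * z τ⁻¹ + 2 * y τ⁻¹ * z τ⁻¹ ^ 2 + τ⁻¹) ∧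
      (((-1) * τ) * deriv (fun τ => w τ⁻¹) τ =
          -2 * z τ⁻¹ * w τ⁻¹ ^ 2 + 2 * z τ⁻¹ * w τ⁻¹ - (1 - 2*a4) * w τ⁻¹
            - 2 * a3 * y τ⁻¹ - 4 * y τ⁻¹ * z τ⁻¹ * w τ⁻¹ + a3))
    filter_upwards [hinfE, hx.deriv_inv, hy.deriv_inv, hz.deriv_inv, hw.deriv_inv]
      with τ h h1 h2 h3 h4
    rw [neg_one_mul, h1, h2, h3, h4]
    exact h
  have hinf := mkLoc (a1 := a1) (a2 := a2) (a3 := a3) (a4 := a4)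
    (E := fun τ => (-1) * τ) (T := fun τ => τ⁻¹) mX mY mZ mW hinfE'
  have hTinf : Lim (fun τ => τ⁻¹) 1 1 := by
    unfold Lim
    refine tendsto_const_nhds.congr' ?_
    filter_upwards [self_mem_nhdsWithin] with τ hτ
    have hτ' : τ ≠ 0 := hτ
    simp [hτ']
  obtain ⟨L, hL⟩ := hinf.x_reg (Lim.kind0 _ hinf.mx) (Lim.kind0 _ hinf.mv) (Lim.kind0 _ hinf.mz)
    (Lim.kind0 _ hinf.ms) hTinf
  obtain ⟨σ, hσ⟩ := hinf.s_reg (Lim.kind0 _ hinf.mx) (Lim.kind0 _ hinf.mv) (Lim.kind0 _ hinf.mz)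
    (Lim.kind0 _ hinf.ms) hTinf hL
  have hk0 : ∀ {f : ℂ → ℂ}, MeromorphicAt f 0 → ∀ n a, Lim f n a →
      ∃ b, Lim (fun τ => (0 + τ) * deriv f τ) n b := by
    intro f hf n a h
    simpa using Lim.kind0 1 hf n a h
  obtain ⟨x0, hx0⟩ := (hloc 0).x_reg (hk0 (hloc 0).mx) (hk0 (hloc 0).mv) (hk0 (hloc 0).mz)
    (hk0 (hloc 0).ms) (lim_shift 0).up
  have hres : ∀ c, ∃ n : ℤ, Lim (fun τ => x (c + τ)) 1 (n * c) := fun c =>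
    (hloc c).x_res (Lim.kindc c (hloc c).mx) (Lim.kindc c (hloc c).mv)
      (Lim.kindc0 c (hloc c).mv) (Lim.kindc c (hloc c).mz) (Lim.kindc0 c (hloc c).mz)
      (Lim.kindc0 c (hloc c).ms) (lim_shift c)
  choose n hn using hres
  have tx0 : Tendsto x (𝓝[≠] 0) (𝓝 x0) := tendsto_shift hx0.lim0
  have txL : Tendsto x atInfty (𝓝 L) := tendsto_atInfty hL.lim0
  refine ⟨⟨x0, L, tx0, txL, residue_int hx tx0 txL n hn⟩, (σ + 1) / 2, ?_⟩
  have hM : Lim (fun τ => y τ⁻¹ + w τ⁻¹) 0 ((σ + 1) / 2) := by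
    refine Lim.congr (((hσ.add (Lim.const 1)).smul (1/2)).cast rfl (by ring)) ?_
    exact Eventually.of_forall fun τ => by ring
  refine ⟨tendsto_atInfty hM.lim0, ?_⟩
  -- the Hamiltonian
  have mT : MeromorphicAt (fun τ : ℂ => τ⁻¹) 0 := (MeromorphicAt.id (𝕜 := ℂ) 0).inv
  have hH := no_residue
    (k := fun τ => x τ⁻¹ ^ 2 * y τ⁻¹ ^ 2 - x τ⁻¹ ^ 2 * y τ⁻¹
      + (1 - 2*a2 - 2*a3 - 2*a4) * (x τ⁻¹ * y τ⁻¹) + 2 * a3 * (z τ⁻¹ * y τ⁻¹)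
      + 2 * (y τ⁻¹ * (z τ⁻¹ ^ 2 * w τ⁻¹)) + τ⁻¹ * y τ⁻¹ - a1 * x τ⁻¹
      + z τ⁻¹ ^ 2 * w τ⁻¹ ^ 2 - z τ⁻¹ ^ 2 * w τ⁻¹ + (1 - 2*a4) * (z τ⁻¹ * w τ⁻¹)
      + τ⁻¹ * w τ⁻¹ - a3 * z τ⁻¹)
    (g := fun τ => y τ⁻¹ + w τ⁻¹) (M := (σ + 1) / 2)
    ((((((((((((((mX.pow 2).mul (mY.pow 2)).sub ((mX.pow 2).mul mY)).add
      ((MeromorphicAt.const _ 0).mul (mX.mul mY))).add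
      ((MeromorphicAt.const _ 0).mul (mZ.mul mY))).add
      ((MeromorphicAt.const _ 0).mul (mY.mul ((mZ.pow 2).mul mW)))).add (mT.mul mY)).sub
      ((MeromorphicAt.const _ 0).mul mX)).add ((mZ.pow 2).mul (mW.pow 2))).sub
      ((mZ.pow 2).mul mW)).add ((MeromorphicAt.const _ 0).mul (mZ.mul mW))).add
      (mT.mul mW)).sub ((MeromorphicAt.const _ 0).mul mZ)))
    (mY.add mW) hM
    (by
      filter_upwards [hinfE', mero_diff mX, mero_diff mY, mero_diff mZ, mero_diff mW,
        self_mem_nhdsWithin] with τ he dX dY dZ dW hτ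
      have hτ' : τ ≠ 0 := hτ
      obtain ⟨e1, e2, e3, e4⟩ := he
      have dX := dX.hasDerivAt
      have dY := dY.hasDerivAt
      have dZ := dZ.hasDerivAt
      have dW := dW.hasDerivAt
      have dT := hasDerivAt_inv hτ'
      have hd := ((((((((((((dX.fun_pow 2).fun_mul (dY.fun_pow 2)).fun_sub ((dX.fun_pow 2).fun_mul dY)).fun_add
        ((dX.fun_mul dY).const_mul (1 - 2*a2 - 2*a3 - 2*a4))).fun_add ((dZ.fun_mul dY).const_mul (2 * a3))).fun_add
        ((dY.fun_mul ((dZ.fun_pow 2).fun_mul dW)).const_mul 2)).fun_add (dT.fun_mul dY)).fun_sub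
        (dX.const_mul a1)).fun_add ((dZ.fun_pow 2).fun_mul (dW.fun_pow 2))).fun_sub
        ((dZ.fun_pow 2).fun_mul dW)).fun_add ((dZ.fun_mul dW).const_mul (1 - 2*a4))).fun_add
        (dT.fun_mul dW)).fun_sub (dZ.const_mul a3)
      rw [hd.deriv]
      generalize deriv (fun τ => x τ⁻¹) τ = X' at *
      generalize deriv (fun τ => y τ⁻¹) τ = Y' at *
      generalize deriv (fun τ => z τ⁻¹) τ = Z' at *
      generalize deriv (fun τ => w τ⁻¹) τ = W' at *
      have hz2 : τ ^ (-2 : ℤ) = τ⁻¹ ^ 2 := by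
        rw [zpow_neg, inv_pow]; norm_cast
      rw [hz2, ← inv_pow]
      have hτi : τ * τ⁻¹ = 1 := mul_inv_cancel₀ hτ'
      generalize τ⁻¹ = t at *
      apply mul_left_cancel₀ hτ'
      norm_num
      linear_combination (-Y' * τ) * e1 + (X' * τ) * e2 - (W' * τ) * e3 + Z' * τ * e4)
  apply tendsto_atInfty
  have := hH
  unfold Lim at this
  refine this.congr fun τ => ?_
  rw [zpow_neg_one]
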